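/- Let c satisfy (B0)–(B1), let u be a c-convex function, and let λ, Λ > 0. Suppose a probability measure γ ≥ 0 on cl U × cl V vanishes outside ∂ᶜu and has marginal densities f⁺ on cl U and f⁻ on cl V (with respect to Lebesgue measure). Then: if f⁺ ≥ λ on U′ ⊂ cl U and f⁻ ≤ Λ on cl V, then |∂ᶜu| ≥ λ/Λ on U′; whereas if f⁺ ≤ Λ on U′ and f⁻ ≥ λ on cl V, then |∂ᶜu| ≤ Λ/λ on U′. -/

import Mathlib

open Set MeasureTheory Metric Bornology
open scoped ENNReal NNReal Pointwise

noncomputable section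

abbrev Euc (n : ℕ) := EuclideanSpace ℝ (Fin n)

/-- Partial gradient of the cost in the first variable: `D_x c(x,y)`. -/
noncomputable def gradX (n : ℕ) (c : Euc n → Euc n → ℝ) (x y : Euc n) : Euc n :=
  gradient (fun x' => c x' y) x

/-- Partial gradient of the cost in the second variable: `D_y c(x,y)`. -/
noncomputable def gradY (n : ℕ) (c : Euc n → Euc n → ℝ) (x y : Euc n) : Euc n :=
  gradient (fun y' => c x y') y

/-- Mixed second derivative `D²_{xy} c` as a continuous linear map. -/
noncomputable def DxyC (n : ℕ) (c : Euc n → Euc n → ℝ) (x y : Euc n) : Euc n →L[ℝ] Euc n :=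
  fderiv ℝ (fun x' => gradY n c x' y) x

/-- Second derivative `D²_{xx} c`. -/
noncomputable def DxxC (n : ℕ) (c : Euc n → Euc n → ℝ) (x y : Euc n) : Euc n →L[ℝ] Euc n :=
  fderiv ℝ (fun x' => gradX n c x' y) x

/-- Third derivative `D²_{xx} D_y c`. -/
noncomputable def DxxyC (n : ℕ) (c : Euc n → Euc n → ℝ) (x y : Euc n) :
    Euc n →L[ℝ] Euc n →L[ℝ] Euc n :=
  fderiv ℝ (fun x' => DxyC n c x' y) x

/-- `β⁺_c = ‖D²_{xy} c‖_{L∞(U×V)}`. -/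
noncomputable def betaPlus (n : ℕ) (c : Euc n → Euc n → ℝ) (U V : Set (Euc n)) : ℝ :=
  sSup ((fun p : Euc n × Euc n => ‖DxyC n c p.1 p.2‖) '' (U ×ˢ V))

/-- `β⁻_c = ‖(D²_{xy} c)⁻¹‖_{L∞(U×V)}`. -/
noncomputable def betaMinus (n : ℕ) (c : Euc n → Euc n → ℝ) (U V : Set (Euc n)) : ℝ :=
  sSup ((fun p : Euc n × Euc n => ‖(DxyC n c p.1 p.2).inverse‖) '' (U ×ˢ V))

/-- `γ⁺_c = ‖det D²_{xy} c‖_{L∞(U×V)}`. -/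
noncomputable def gammaPlus (n : ℕ) (c : Euc n → Euc n → ℝ) (U V : Set (Euc n)) : ℝ :=
  sSup ((fun p : Euc n × Euc n =>
    |LinearMap.det ((DxyC n c p.1 p.2 : Euc n →L[ℝ] Euc n) : Euc n →ₗ[ℝ] Euc n)|) '' (U ×ˢ V))

/-- `γ⁻_c = ‖(det D²_{xy} c)⁻¹‖_{L∞(U×V)}`. -/
noncomputable def gammaMinus (n : ℕ) (c : Euc n → Euc n → ℝ) (U V : Set (Euc n)) : ℝ :=
  sSup ((fun p : Euc n × Euc n =>
    |LinearMap.det ((DxyC n c p.1 p.2 : Euc n →L[ℝ] Euc n) : Euc n →ₗ[ℝ] Euc n)|⁻¹) '' (U ×ˢ V))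

noncomputable def supDxx (n : ℕ) (c : Euc n → Euc n → ℝ) (U V : Set (Euc n)) : ℝ :=
  sSup ((fun p : Euc n × Euc n => ‖DxxC n c p.1 p.2‖) '' (U ×ˢ V))

noncomputable def supDx (n : ℕ) (c : Euc n → Euc n → ℝ) (U V : Set (Euc n)) : ℝ :=
  sSup ((fun p : Euc n × Euc n => ‖gradX n c p.1 p.2‖) '' (U ×ˢ V))

noncomputable def supDxxy (n : ℕ) (c : Euc n → Euc n → ℝ) (U V : Set (Euc n)) : ℝ :=
  sSup ((fun p : Euc n × Euc n => ‖DxxyC n c p.1 p.2‖) '' (U ×ˢ V))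

/-- The constant `M_c` from Theorem 4.3. -/
noncomputable def Mconst (n : ℕ) (c : Euc n → Euc n → ℝ) (U V : Set (Euc n)) : ℝ :=
  (betaMinus n c U V) ^ 2 * supDxx n c U V +
    (betaMinus n c U V) ^ 3 * supDx n c U V * supDxxy n c U V

/-- The constant `ε_c` of Lemma 6.1: `1/ε_c = 2 (β⁺)⁴ (β⁻)⁶ ‖D³_{xxy} c‖_∞`. -/
noncomputable def epsC (n : ℕ) (c : Euc n → Euc n → ℝ) (U V : Set (Euc n)) : ℝ :=
  (2 * (betaPlus n c U V) ^ 4 * (betaMinus n c U V) ^ 6 * supDxxy n c U V)⁻¹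

/-- Condition (B0). -/
def B0cond (n : ℕ) (c : Euc n → Euc n → ℝ) (U V : Set (Euc n)) : Prop :=
  IsOpen U ∧ IsBounded U ∧ IsOpen V ∧ IsBounded V ∧
    ContDiffOn ℝ 4 (Function.uncurry c) (closure U ×ˢ closure V)

/-- `f` is a (C¹-) diffeomorphism from `S` onto its range. -/
def DiffeoOnto (n : ℕ) (f : Euc n → Euc n) (S : Set (Euc n)) : Prop :=
  Set.InjOn f S ∧ ContDiffOn ℝ 1 f S ∧ ContDiffOn ℝ 1 (Function.invFunOn f S) (f '' S)

/-- Condition (B1) (bi-twist). -/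
def B1cond (n : ℕ) (c : Euc n → Euc n → ℝ) (U V : Set (Euc n)) : Prop :=
  (∀ y ∈ closure V, DiffeoOnto n (fun x => -gradY n c x y) (closure U)) ∧
  (∀ x ∈ closure U, DiffeoOnto n (fun y => -gradX n c x y) (closure V))

/-- `U_ȳ := -D_y c(U, ȳ)`. -/
def Uyset (n : ℕ) (c : Euc n → Euc n → ℝ) (U : Set (Euc n)) (ybar : Euc n) : Set (Euc n) :=
  (fun x => -gradY n c x ybar) '' U

/-- `V_x̄ := -D_x c(x̄, V)`. -/
def Vxset (n : ℕ) (c : Euc n → Euc n → ℝ) (V : Set (Euc n)) (xbar : Euc n) : Set (Euc n) :=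
  (fun y => -gradX n c xbar y) '' V

/-- Condition (B2) (bi-convexity). -/
def B2cond (n : ℕ) (c : Euc n → Euc n → ℝ) (U V : Set (Euc n)) : Prop :=
  (∀ y ∈ closure V, Convex ℝ (Uyset n c U y)) ∧ (∀ x ∈ closure U, Convex ℝ (Vxset n c V x))

/-- A strongly convex set: each boundary point is touched from outside by a sphere of
radius `R` enclosing the set. -/
def StronglyConvexSet (n : ℕ) (Q : Set (Euc n)) : Prop :=
  Convex ℝ Q ∧ ∃ R : ℝ, 0 < R ∧ ∀ x ∈ frontier Q, ∃ z : Euc n, dist x z = R ∧ Q ⊆ closedBall z R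

/-- Condition (B2s). -/
def B2scond (n : ℕ) (c : Euc n → Euc n → ℝ) (U V : Set (Euc n)) : Prop :=
  (∀ y ∈ closure V, StronglyConvexSet n (Uyset n c U y)) ∧
  (∀ x ∈ closure U, StronglyConvexSet n (Vxset n c V x))

/-- An affinely parameterized line segment on `[-1,1]`. -/
def IsAffineSeg (n : ℕ) (F : ℝ → Euc n × Euc n) : Prop :=
  ∃ a b : Euc n × Euc n, ∀ t ∈ Icc (-1 : ℝ) 1, F t = a + t • b

/-- `∂²/∂s∂t c(x(s), y(t))` at `(0,0)`. -/
noncomputable def crossDiff2 (n : ℕ) (c : Euc n → Euc n → ℝ) (x y : ℝ → Euc n) : ℝ :=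
  deriv (fun s => deriv (fun t => c (x s) (y t)) 0) 0

/-- `∂⁴/∂s²∂t² c(x(s), y(t))` at `(0,0)`. -/
noncomputable def crossDiff4 (n : ℕ) (c : Euc n → Euc n → ℝ) (x y : ℝ → Euc n) : ℝ :=
  deriv (deriv (fun s => deriv (deriv (fun t => c (x s) (y t))) 0)) 0

/-- Condition (B3) (= A3w). -/
def B3cond (n : ℕ) (c : Euc n → Euc n → ℝ) (U V : Set (Euc n)) : Prop :=
  ∀ x y : ℝ → Euc n, (∀ t ∈ Icc (-1 : ℝ) 1, x t ∈ closure U) →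
    (∀ t ∈ Icc (-1 : ℝ) 1, y t ∈ closure V) →
    IsAffineSeg n (fun t => (gradY n c (x t) (y 0), gradX n c (x 0) (y t))) →
    crossDiff2 n c x y = 0 → crossDiff4 n c x y ≤ 0

/-- Condition (B4) (non-negative cross-curvature). -/
def B4cond (n : ℕ) (c : Euc n → Euc n → ℝ) (U V : Set (Euc n)) : Prop :=
  ∀ x y : ℝ → Euc n, (∀ t ∈ Icc (-1 : ℝ) 1, x t ∈ closure U) →
    (∀ t ∈ Icc (-1 : ℝ) 1, y t ∈ closure V) →
    IsAffineSeg n (fun t => (gradY n c (x t) (y 0), gradX n c (x 0) (y t))) →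
    crossDiff4 n c x y ≤ 0

/-- The `c*`-transform `u^{c*}(y) = sup_{x ∈ A} (-c(x,y) - u(x))`. -/
noncomputable def cStarT (n : ℕ) (c : Euc n → Euc n → ℝ) (A : Set (Euc n)) (u : Euc n → ℝ)
    (y : Euc n) : ℝ :=
  sSup ((fun x => -c x y - u x) '' A)

/-- `u` is `c`-convex on `A` (relative to the target set `B`): `u = (u^{c*})^c`. -/
def CConvexOn (n : ℕ) (c : Euc n → Euc n → ℝ) (A B : Set (Euc n)) (u : Euc n → ℝ) : Prop :=
  ∀ x ∈ A, u x = sSup ((fun y => -c x y - cStarT n c A u y) '' B)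

/-- The `c`-subdifferential `∂ᶜu ⊂ A × B`. -/
def cSubdiff (n : ℕ) (c : Euc n → Euc n → ℝ) (A B : Set (Euc n)) (u : Euc n → ℝ) :
    Set (Euc n × Euc n) :=
  {p | p.1 ∈ A ∧ p.2 ∈ B ∧ u p.1 + cStarT n c A u p.2 + c p.1 p.2 = 0}

def cSubdiffAt (n : ℕ) (c : Euc n → Euc n → ℝ) (A B : Set (Euc n)) (u : Euc n → ℝ)
    (x : Euc n) : Set (Euc n) :=
  {y | (x, y) ∈ cSubdiff n c A B u}

def cSubdiffImg (n : ℕ) (c : Euc n → Euc n → ℝ) (A B : Set (Euc n)) (u : Euc n → ℝ)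
    (X : Set (Euc n)) : Set (Euc n) :=
  ⋃ x ∈ X, cSubdiffAt n c A B u x

/-- `∂^{c*}u^{c*}(Y) = {x : ∃ y ∈ Y, (x,y) ∈ ∂ᶜu}`. -/
def cSubdiffPre (n : ℕ) (c : Euc n → Euc n → ℝ) (A B : Set (Euc n)) (u : Euc n → ℝ)
    (Y : Set (Euc n)) : Set (Euc n) :=
  {x | ∃ y ∈ Y, (x, y) ∈ cSubdiff n c A B u}

/-- `|∂ᶜu| ≥ lam` on `S`. -/
def MAge (n : ℕ) (c : Euc n → Euc n → ℝ) (A B : Set (Euc n)) (u : Euc n → ℝ) (lam : ℝ)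
    (S : Set (Euc n)) : Prop :=
  ∀ X : Set (Euc n), X ⊆ S → MeasurableSet X →
    ENNReal.ofReal lam * volume X ≤ volume (cSubdiffImg n c A B u X)

/-- `|∂ᶜu| ≤ lam` on `S`. -/
def MAle (n : ℕ) (c : Euc n → Euc n → ℝ) (A B : Set (Euc n)) (u : Euc n → ℝ) (lam : ℝ)
    (S : Set (Euc n)) : Prop :=
  ∀ X : Set (Euc n), X ⊆ S → MeasurableSet X →
    volume (cSubdiffImg n c A B u X) ≤ ENNReal.ofReal lam * volume X

/-- The inverse of the cost-exponential coordinate change `q(x) = -D_y c(x, ȳ)`. -/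
noncomputable def xOf (n : ℕ) (c : Euc n → Euc n → ℝ) (U : Set (Euc n)) (ybar : Euc n) :
    Euc n → Euc n :=
  Function.invFunOn (fun x => -gradY n c x ybar) (closure U)

/-- `cl U_ȳ := -D_y c(cl U, ȳ)`. -/
def clUy (n : ℕ) (c : Euc n → Euc n → ℝ) (U : Set (Euc n)) (ybar : Euc n) : Set (Euc n) :=
  (fun x => -gradY n c x ybar) '' closure U

/-- The modified cost `c̃(q,y) = c(x(q), y) - c(x(q), ȳ)`. -/
noncomputable def modCost (n : ℕ) (c : Euc n → Euc n → ℝ) (U : Set (Euc n)) (ybar : Euc n)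
    (q y : Euc n) : ℝ :=
  c (xOf n c U ybar q) y - c (xOf n c U ybar q) ybar

/-- The modified potential `ũ(q) = u(x(q)) + c(x(q), ȳ)`. -/
noncomputable def modPot (n : ℕ) (c : Euc n → Euc n → ℝ) (U : Set (Euc n)) (ybar : Euc n)
    (u : Euc n → ℝ) (q : Euc n) : ℝ :=
  u (xOf n c U ybar q) + c (xOf n c U ybar q) ybar

/-- The `c̃`-cone generated by `qt` and `Q` with height `-h0 > 0`. -/
noncomputable def cConeFun (n : ℕ) (ct : Euc n → Euc n → ℝ) (B Q : Set (Euc n)) (qt : Euc n)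
    (h0 : ℝ) (q : Euc n) : ℝ :=
  sSup {r : ℝ | ∃ y ∈ B, r = -ct q y + ct qt y + h0 ∧
    ∀ p ∈ frontier Q, -ct p y + ct qt y + h0 ≤ 0}

/-- The ordinary subdifferential `∂u(x)` relative to a domain `A`. -/
def subdiffAt (n : ℕ) (A : Set (Euc n)) (u : Euc n → ℝ) (x : Euc n) : Set (Euc n) :=
  {p | ∀ ε > 0, ∃ δ > 0, ∀ x' ∈ A, ‖x' - x‖ < δ →
    u x + @inner ℝ _ _ p (x' - x) - ε * ‖x' - x‖ ≤ u x'}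

/-- The dual norm `‖v‖*_K = sup_{w ∈ K} ⟨w, v⟩`. -/
noncomputable def dualNorm (n : ℕ) (K : Set (Euc n)) (v : Euc n) : ℝ :=
  sSup ((fun w => (@inner ℝ _ _ w v : ℝ)) '' K)

/-- The section `S(x̄, ȳ, τ)`. -/
def sectS (n : ℕ) (c : Euc n → Euc n → ℝ) (U : Set (Euc n)) (u : Euc n → ℝ)
    (xbar ybar : Euc n) (τ : ℝ) : Set (Euc n) :=
  {x ∈ U | u x ≤ u xbar - c x ybar + c xbar ybar + τ}

/-- The measure with density `f` restricted to `A`. -/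
noncomputable def densMeasure (n : ℕ) (A : Set (Euc n)) (f : Euc n → ℝ) : Measure (Euc n) :=
  (volume.restrict A).withDensity fun x => ENNReal.ofReal (f x)

end
open Filter Topology

/-- At a density point of a set, every direction is in the positive tangent cone. -/
theorem aux_density_cone {n : ℕ} (s : Set (Euc n)) (x : Euc n)
    (h : Tendsto (fun r => volume (s ∩ closedBall x r) / volume (closedBall x r)) (𝓝[>] 0) (𝓝 1))
    (z : Euc n) : z ∈ posTangentConeAt s x := by
  unfold posTangentConeAt
  rw [tangentConeAt_eq_biInter_closure]
  simp only [mem_iInter]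
  intro W hW
  rw [Metric.mem_closure_iff]
  intro ε εpos
  have B₁ : ∀ᶠ r in 𝓝[>] (0 : ℝ), (s ∩ ({x} + r • closedBall z (ε/2))).Nonempty :=
    Measure.eventually_nonempty_inter_smul_of_density_one volume s x h _ measurableSet_closedBall
      (measure_closedBall_pos volume z (half_pos εpos)).ne'
  have B₂ : ∀ᶠ r in 𝓝[>] (0 : ℝ), {(0 : Euc n)} + r • closedBall z (ε/2) ⊆ W := by
    apply nhdsWithin_le_nhds
    exact eventually_singleton_add_smul_subset isBounded_closedBall hW
  obtain ⟨r, ⟨y, ⟨ys, hy⟩⟩, rρ, rpos⟩ := (B₁.and (B₂.and self_mem_nhdsWithin)).exists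
  have rpos : 0 < r := rpos
  obtain ⟨a, az, ya⟩ : ∃ a, a ∈ closedBall z (ε/2) ∧ y = x + r • a := by
    simp only [mem_smul_set, image_add_left, mem_preimage, singleton_add] at hy
    rcases hy with ⟨a, az, ha⟩
    exact ⟨a, az, by simp only [ha, add_neg_cancel_left]⟩
  refine ⟨a, ?_, ?_⟩
  · refine Set.mem_smul.2 ⟨⟨r⁻¹, by positivity⟩, mem_univ _, r • a, ⟨rρ ?_, ?_⟩, ?_⟩
    · simpa using smul_mem_smul_set (a := r) az
    · simpa [← ya] using ys
    · change r⁻¹ • r • a = a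
      rw [smul_smul, inv_mul_cancel₀ rpos.ne', one_smul]
  · rw [dist_comm]
    have := mem_closedBall.1 az
    linarith

theorem aux_min_zero {n : ℕ} (s : Set (Euc n)) (x : Euc n)
    (h : ∀ z, z ∈ posTangentConeAt s x) (f : Euc n → ℝ) (A : Euc n →L[ℝ] ℝ)
    (hf : HasFDerivWithinAt f A s x) (hmin : ∀ y ∈ s, f x ≤ f y) : A = 0 := by
  have hm : IsLocalMinOn f s x := by
    filter_upwards [self_mem_nhdsWithin] with y hy using hmin y hy
  ext z
  exact hm.hasFDerivWithinAt_eq_zero hf (h z) (h (-z))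

theorem aux_unique {n : ℕ} (s : Set (Euc n)) (x : Euc n)
    (h : ∀ z, z ∈ posTangentConeAt s x) (f : Euc n → ℝ) (A B : Euc n →L[ℝ] ℝ)
    (hA : HasFDerivWithinAt f A s x) (hB : HasFDerivWithinAt f B s x) : A = B := by
  have := aux_min_zero s x h _ _ (hA.sub hB) (by intro y _; simp)
  exact sub_eq_zero.1 this

theorem aux_bdd {n : ℕ} {c : Euc n → Euc n → ℝ} {A B : Set (Euc n)} {u : Euc n → ℝ}
    (hA : IsCompact A) (hB : IsCompact B) 
    (hB0 : B.Nonempty) (hc : ContinuousOn (Function.uncurry c) (A ×ˢ B))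
    (hu : CConvexOn n c A B u) :
    ∀ y ∈ B, BddAbove ((fun x => -c x y - u x) '' A) := by
  obtain ⟨M, hM⟩ := (hA.prod hB).exists_bound_of_continuousOn hc
  have hM' : ∀ x ∈ A, ∀ y ∈ B, |c x y| ≤ M := fun x hx y hy => hM (x, y) ⟨hx, hy⟩
  intro y hy
  by_contra hn
  have hall : ∀ y' ∈ B, cStarT n c A u y' = 0 := by
    intro y' hy'
    apply Real.sSup_of_not_bddAbove
    rintro ⟨R, hR⟩
    apply hn
    refine ⟨R + 2 * M, ?_⟩
    rintro _ ⟨x, hx, rfl⟩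
    have h1 := hR ⟨x, hx, rfl⟩
    have h2 := abs_le.1 (hM' x hx y hy)
    have h3 := abs_le.1 (hM' x hx y' hy')
    simp only at h1 ⊢
    linarith
  apply hn
  refine ⟨2 * M, ?_⟩
  rintro _ ⟨x, hx, rfl⟩
  have h2 := abs_le.1 (hM' x hx y hy)
  have h3 : -c x y - cStarT n c A u y ≤ u x := by
    rw [hu x hx]
    refine le_csSup ?_ (mem_image_of_mem (fun y => -c x y - cStarT n c A u y) hy)
    refine ⟨M, ?_⟩
    rintro _ ⟨y', hy', rfl⟩
    have := abs_le.1 (hM' x hx y' hy')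
    simp only [hall y' hy']
    linarith
  rw [hall y hy] at h3
  simp only
  linarith

theorem aux_bdd2 {n : ℕ} {c : Euc n → Euc n → ℝ} {A B : Set (Euc n)} {u : Euc n → ℝ}
    (hb : ∀ y ∈ B, BddAbove ((fun x => -c x y - u x) '' A)) :
    ∀ x ∈ A, BddAbove ((fun y => -c x y - cStarT n c A u y) '' B) := by
  intro x hx
  refine ⟨u x, ?_⟩
  rintro _ ⟨y, hy, rfl⟩
  have : -c x y - u x ≤ cStarT n c A u y := le_csSup (hb y hy) ⟨x, hx, rfl⟩
  simp only
  linarith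

theorem aux_closed {n : ℕ} {c : Euc n → Euc n → ℝ} {A B : Set (Euc n)} {u : Euc n → ℝ}
    (hA : IsClosed A) (hB : IsClosed B) (hA0 : A.Nonempty)
    (hB0 : B.Nonempty) (hc : ContinuousOn (Function.uncurry c) (A ×ˢ B))
    (hu : CConvexOn n c A B u)
    (hb : ∀ y ∈ B, BddAbove ((fun x => -c x y - u x) '' A)) :
    IsClosed (cSubdiff n c A B u) := by
  have hb2 := aux_bdd2 hb
  have key : cSubdiff n c A B u = ⋂ x' ∈ A, ⋂ y' ∈ B,
      (A ×ˢ B) ∩ (fun p : Euc n × Euc n => -c p.1 y' - cStarT n c A u y' +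
        (-c x' p.2 - u x') + c p.1 p.2) ⁻¹' Iic 0 := by
    ext p
    simp only [cSubdiff, mem_iInter, mem_ofPred_eq]
    constructor
    · rintro ⟨h1, h2, h3⟩ x' hx' y' hy'
      refine ⟨⟨h1, h2⟩, ?_⟩
      have e1 : -c p.1 y' - cStarT n c A u y' ≤ u p.1 := by
        rw [hu _ h1]; exact le_csSup (hb2 _ h1) ⟨y', hy', rfl⟩
      have e2 : -c x' p.2 - u x' ≤ cStarT n c A u p.2 := le_csSup (hb _ h2) ⟨x', hx', rfl⟩
      simp only [mem_preimage, mem_Iic]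
      linarith
    · intro h
      obtain ⟨a0, ha0⟩ := hA0
      obtain ⟨b0, hb0⟩ := hB0
      have hK := (h a0 ha0 b0 hb0).1
      refine ⟨hK.1, hK.2, le_antisymm ?_ ?_⟩
      · have e2 : cStarT n c A u p.2 ≤ - u p.1 - c p.1 p.2 := by
          apply csSup_le (Set.Nonempty.image _ ⟨a0, ha0⟩)
          rintro _ ⟨x', hx', rfl⟩
          have e1 : u p.1 ≤ -(-c x' p.2 - u x') - c p.1 p.2 := by
            rw [hu _ hK.1]
            apply csSup_le (Set.Nonempty.image _ ⟨b0, hb0⟩)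
            rintro _ ⟨y', hy', rfl⟩
            have := (h x' hx' y' hy').2
            simp only [mem_preimage, mem_Iic] at this
            simp only
            linarith
          simp only
          linarith
        linarith
      · have e2 : -c p.1 p.2 - u p.1 ≤ cStarT n c A u p.2 := le_csSup (hb _ hK.2) ⟨_, hK.1, rfl⟩
        linarith
  rw [key]
  refine isClosed_biInter fun x' hx' => isClosed_biInter fun y' hy' => ?_
  refine ContinuousOn.preimage_isClosed_of_isClosed ?_ (hA.prod hB) isClosed_Iic
  have c1 : ContinuousOn (fun p : Euc n × Euc n => c p.1 y') (A ×ˢ B) :=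
    hc.comp (f := fun p : Euc n × Euc n => (p.1, y')) (by fun_prop) (fun p hp => ⟨hp.1, hy'⟩)
  have c2 : ContinuousOn (fun p : Euc n × Euc n => c x' p.2) (A ×ˢ B) :=
    hc.comp (f := fun p : Euc n × Euc n => (x', p.2)) (by fun_prop) (fun p hp => ⟨hx', hp.2⟩)
  have c3 : ContinuousOn (fun p : Euc n × Euc n => c p.1 p.2) (A ×ˢ B) := hc
  exact ((c1.neg.sub continuousOn_const).add (c2.neg.sub continuousOn_const)).add c3

theorem aux_slice {n : ℕ} {c : Euc n → Euc n → ℝ} {A B : Set (Euc n)} {x y : Euc n}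
    {F : Euc n × Euc n →L[ℝ] ℝ} (hx : x ∈ A)
    (h : HasFDerivWithinAt (Function.uncurry c) F (A ×ˢ B) (x, y)) :
    HasFDerivWithinAt (fun y' => c x y') (F.comp (ContinuousLinearMap.inr ℝ (Euc n) (Euc n))) B y := by
  have h2 : HasFDerivWithinAt (fun y' : Euc n => (x, y'))
      (ContinuousLinearMap.inr ℝ (Euc n) (Euc n)) B y := (hasFDerivAt_prodMk_right x y).hasFDerivWithinAt
  exact HasFDerivWithinAt.comp (f := fun y' : Euc n => (x, y')) y h h2 (fun y' hy' => ⟨hx, hy'⟩)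

/-- At points `y` where tangent directions are full, `gradY` is the derivative within. -/
theorem aux_grad {n : ℕ} {c : Euc n → Euc n → ℝ} {A B : Set (Euc n)} {y : Euc n}
    (hc : ContDiffOn ℝ 4 (Function.uncurry c) (A ×ˢ B)) (hy : y ∈ B)
    (hcone : ∀ z, z ∈ posTangentConeAt B y)
    (hacc : Preperfect A)
    (hinj : InjOn (fun x => -gradY n c x y) A)
    (hcont : ContinuousOn (fun x => -gradY n c x y) A) :
    ∀ x ∈ A, HasFDerivWithinAt (fun y' => c x y') (innerSL ℝ (gradY n c x y)) B y := by
  have hdiff : ∀ x, DifferentiableAt ℝ (fun y' => c x y') y →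
      HasFDerivWithinAt (fun y' => c x y') (innerSL ℝ (gradY n c x y)) B y := by
    intro x h
    exact h.hasGradientAt.hasFDerivAt.hasFDerivWithinAt
  intro x hx
  by_cases hd : DifferentiableAt ℝ (fun y' => c x y') y
  · exact hdiff x hd
  have hg0 : gradY n c x y = 0 := by
    simp [gradY, gradient, fderiv_zero_of_not_differentiableAt hd]
  have hothers : ∀ x' ∈ A, x' ≠ x → DifferentiableAt ℝ (fun y' => c x' y') y := by
    intro x' hx' hne
    by_contra hd'
    have hg1 : gradY n c x' y = 0 := by
      simp [gradY, gradient, fderiv_zero_of_not_differentiableAt hd']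
    exact hne (hinj hx' hx (by simp [hg0, hg1]))
  have hcw : ContDiffWithinAt ℝ (0 + 1) (Function.uncurry c) (A ×ˢ B) (x, y) :=
    (hc (x, y) ⟨hx, hy⟩).of_le (by norm_num)
  obtain ⟨w, hw, hws, -, F, hF, hFc⟩ :=
    (contDiffWithinAt_succ_iff_hasFDerivWithinAt' (by simp)).1 hcw
  have hxy : (x, y) ∈ A ×ˢ B := ⟨hx, hy⟩
  rw [insert_eq_of_mem hxy] at hw hws
  have hmaps : Tendsto (fun x' : Euc n => (x', y)) (𝓝[A \ {x}] x) (𝓝[A ×ˢ B] (x, y)) := by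
    apply tendsto_nhdsWithin_of_tendsto_nhds_of_eventually_within
    · exact ((Continuous.prodMk_left y).tendsto x).mono_left nhdsWithin_le_nhds
    · filter_upwards [self_mem_nhdsWithin] with x' hx' using ⟨hx'.1, hy⟩
  have hl1 : Tendsto (fun x' => (F (x', y)).comp (ContinuousLinearMap.inr ℝ (Euc n) (Euc n)))
      (𝓝[A \ {x}] x) (𝓝 ((F (x, y)).comp (ContinuousLinearMap.inr ℝ (Euc n) (Euc n)))) := by
    have h1 : Tendsto (fun x' => F (x', y)) (𝓝[A \ {x}] x) (𝓝 (F (x, y))) :=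
      hFc.continuousWithinAt.tendsto.comp hmaps
    exact (((ContinuousLinearMap.compL ℝ (Euc n) (Euc n × Euc n) ℝ).flip
      (ContinuousLinearMap.inr ℝ (Euc n) (Euc n))).continuous.tendsto _).comp h1
  have hl2 : Tendsto (fun x' => innerSL ℝ (gradY n c x' y))
      (𝓝[A \ {x}] x) (𝓝 (innerSL ℝ (gradY n c x y))) := by
    have h1 : Tendsto (fun x' => gradY n c x' y) (𝓝[A \ {x}] x) (𝓝 (gradY n c x y)) := by
      have := ((hcont x hx).mono (sdiff_subset (t := {x}))).tendsto.neg
      simpa using this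
    exact ((innerSL ℝ).continuous.tendsto _).comp h1
  have heq : ∀ᶠ x' in 𝓝[A \ {x}] x, innerSL ℝ (gradY n c x' y) =
      (F (x', y)).comp (ContinuousLinearMap.inr ℝ (Euc n) (Euc n)) := by
    filter_upwards [self_mem_nhdsWithin, hmaps hw] with x' hx' hxw
    exact aux_unique B y hcone _ _ _ (hdiff x' (hothers x' hx'.1 hx'.2))
      (aux_slice hx'.1 (hF _ hxw))
  have hne : (𝓝[A \ {x}] x).NeBot := by
    have := hacc x hx
    rwa [accPt_principal_iff_nhdsWithin] at this
  have := tendsto_nhds_unique hl2 (hl1.congr' (heq.mono fun _ h => h.symm))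
  rw [this]
  exact aux_slice hx (hF _ (mem_of_mem_nhdsWithin hxy hw))

/-- Almost every `y` has at most one `x` with `(x, y) ∈ ∂ᶜu`. -/
theorem aux_null {n : ℕ} {c : Euc n → Euc n → ℝ} {A B : Set (Euc n)} {u : Euc n → ℝ}
    (hc : ContDiffOn ℝ 4 (Function.uncurry c) (A ×ˢ B))
    (hacc : Preperfect A)
    (htw : ∀ y ∈ B, DiffeoOnto n (fun x => -gradY n c x y) A)
    (hb : ∀ y ∈ B, BddAbove ((fun x => -c x y - u x) '' A)) :
    ∀ᵐ y ∂(volume : Measure (Euc n)), ∀ x₁ x₂, (x₁, y) ∈ cSubdiff n c A B u →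
      (x₂, y) ∈ cSubdiff n c A B u → x₁ = x₂ := by
  set v := cStarT n c A u with hv
  have hvle : ∀ x ∈ A, ∀ y ∈ B, -c x y - u x ≤ v y := fun x hx y hy =>
    le_csSup (hb y hy) (mem_image_of_mem (fun x => -c x y - u x) hx)
  let q := TopologicalSpace.denseSeq (Euc n)
  let S : ℕ → ℕ → Set (Euc n) := fun k i =>
    {y | y ∈ B ∧ dist y (q i) < 1 / (2 * ((k : ℝ) + 1)) ∧
      ∀ y' ∈ B, dist y' y < 1 / ((k : ℝ) + 1) → v y - (k : ℝ) * dist y' y ≤ v y'}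
  have hlip : ∀ (k i : ℕ), LipschitzOnWith (k : ℝ≥0) v (S k i) := by
    intro k i
    have hk : 1 / (2 * ((k : ℝ) + 1)) + 1 / (2 * ((k : ℝ) + 1)) = 1 / ((k : ℝ) + 1) := by
      field_simp; norm_num
    apply LipschitzOnWith.of_dist_le_mul
    intro y hy z hz
    have hd : dist y z < 1 / ((k : ℝ) + 1) := by
      have := dist_triangle_right y z (q i)
      have h1 := hy.2.1
      have h2 := hz.2.1
      linarith
    have e1 := hz.2.2 y hy.1 hd
    have e2 := hy.2.2 z hz.1 (by rwa [dist_comm])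
    rw [dist_comm z y] at e2
    rw [Real.dist_eq, abs_le]
    simp only [NNReal.coe_natCast]
    constructor <;> linarith
  have hae : ∀ᵐ y ∂(volume : Measure (Euc n)), ∀ k i, y ∈ S k i →
      DifferentiableWithinAt ℝ v (S k i) y ∧
      Tendsto (fun r => volume (S k i ∩ closedBall y r) / volume (closedBall y r))
        (𝓝[>] 0) (𝓝 1) := by
    rw [ae_all_iff]; intro k
    rw [ae_all_iff]; intro i
    have h1 := (hlip k i).ae_differentiableWithinAt_of_mem (μ := volume)
    have h2 : ∀ᵐ y ∂(volume : Measure (Euc n)), y ∈ S k i →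
      Tendsto (fun r => volume (S k i ∩ closedBall y r) / volume (closedBall y r))
        (𝓝[>] 0) (𝓝 1) :=
      ae_imp_of_ae_restrict (Besicovitch.ae_tendsto_measure_inter_div volume (S k i))
    filter_upwards [h1, h2] with y a b hy using ⟨a hy, b hy⟩
  filter_upwards [hae] with y hy x₁ x₂ h₁ h₂
  have hyB : y ∈ B := h₁.2.1
  -- `y` belongs to one of the sets `S k i`
  obtain ⟨k, i, hki⟩ : ∃ k i, y ∈ S k i := by
    have hd : HasFDerivWithinAt (fun y' => c x₁ y') _ B y :=
      aux_slice h₁.1 ((hc (x₁, y) ⟨h₁.1, hyB⟩).differentiableWithinAt (by norm_num)).hasFDerivWithinAt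
    obtain ⟨C, hC⟩ := hd.isBigO_sub.bound
    obtain ⟨ρ, ρpos, hρ⟩ := Metric.mem_nhdsWithin_iff.1 hC
    obtain ⟨k₁, hk₁⟩ := exists_nat_ge C
    obtain ⟨k₂, hk₂⟩ := exists_nat_one_div_lt ρpos
    let k := max k₁ k₂
    have hkC : C ≤ (k : ℝ) := hk₁.trans (by exact_mod_cast le_max_left _ _)
    have hkρ : 1 / ((k : ℝ) + 1) ≤ ρ := by
      refine le_trans ?_ hk₂.le
      have : (k₂ : ℝ) ≤ k := by exact_mod_cast le_max_right _ _
      gcongr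
    have hpos : 0 < 1 / (2 * ((k : ℝ) + 1)) := by positivity
    obtain ⟨i, hi⟩ := (TopologicalSpace.denseRange_denseSeq (Euc n)).exists_dist_lt y hpos
    refine ⟨k, i, hyB, hi, ?_⟩
    intro y' hy' hdist
    have h3 := hρ ⟨mem_ball.2 (lt_of_lt_of_le hdist hkρ), hy'⟩
    simp only [mem_ofPred_eq, Real.norm_eq_abs] at h3
    rw [← dist_eq_norm] at h3
    have h4 := (abs_le.1 h3).2
    have h5 := hvle x₁ h₁.1 y' hy'
    have h6 : u x₁ + v y + c x₁ y = 0 := h₁.2.2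
    have h7 : C * dist y' y ≤ k * dist y' y := by gcongr
    linarith
  obtain ⟨hvd, hdens⟩ := hy k i hki
  have hcone := aux_density_cone (S k i) y hdens
  have hsub : S k i ⊆ B := fun z hz => hz.1
  have hconeB : ∀ z, z ∈ posTangentConeAt B y := fun z => posTangentConeAt_mono hsub (hcone z)
  have hgrad := aux_grad hc hyB hconeB hacc (htw y hyB).1 (htw y hyB).2.1.continuousOn
  have key : ∀ x, (x, y) ∈ cSubdiff n c A B u →
      fderivWithin ℝ v (S k i) y + innerSL ℝ (gradY n c x y) = 0 := by
    intro x hx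
    refine aux_min_zero (S k i) y hcone (fun y' => v y' + c x y') _
      (hvd.hasFDerivWithinAt.add ((hgrad x hx.1).mono hsub)) ?_
    intro y' hy'
    have h5 := hvle x hx.1 y' hy'.1
    have h6 : u x + v y + c x y = 0 := hx.2.2
    linarith
  have hi : innerSL ℝ (gradY n c x₁ y) = innerSL ℝ (gradY n c x₂ y) :=
    add_left_cancel ((key x₁ h₁).trans (key x₂ h₂).symm)
  have hi' : gradY n c x₁ y = gradY n c x₂ y := by
    apply ext_inner_right ℝ
    intro z
    simpa using congrArg (fun L => L z) hi
  exact (htw y hyB).1 h₁.1 h₂.1 (by simp [hi'])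

/-- Lemma 3.1(e): marginal density bounds for a probability measure `γ`
vanishing outside `∂ᶜu` imply bounds on the `c`-Monge–Ampère measure `|∂ᶜu|`. -/
theorem cMA_bounds_from_marginal_densities (n : ℕ) (c : Euc n → Euc n → ℝ)
    (U V U' : Set (Euc n)) (u : Euc n → ℝ) (lam Lam : ℝ)
    (γ : Measure (Euc n × Euc n)) (fp fm : Euc n → ℝ)
    (hB0 : B0cond n c U V) (hB1 : B1cond n c U V)
    (hu : CConvexOn n c (closure U) (closure V) u)
    (hlam : 0 < lam) (hLam : 0 < Lam)
    (hU' : U' ⊆ closure U)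
    (hγ : IsProbabilityMeasure γ)
    (hnull : γ (cSubdiff n c (closure U) (closure V) u)ᶜ = 0)
    (hfst : γ.map Prod.fst = volume.withDensity fun x => ENNReal.ofReal (fp x))
    (hsnd : γ.map Prod.snd = volume.withDensity fun y => ENNReal.ofReal (fm y)) :
    ((∀ x ∈ U', lam ≤ fp x) → (∀ y ∈ closure V, fm y ≤ Lam) →
      MAge n c (closure U) (closure V) u (lam / Lam) U') ∧
    ((∀ x ∈ U', fp x ≤ Lam) → (∀ y ∈ closure V, lam ≤ fm y) →
      MAle n c (closure U) (closure V) u (Lam / lam) U') := by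
  obtain ⟨hUo, hUb, hVo, hVb, hc⟩ := hB0
  have hAc : IsCompact (closure U) := hUb.isCompact_closure
  have hBc : IsCompact (closure V) := hVb.isCompact_closure
  have hmemN : ∀ᵐ p ∂γ, p ∈ cSubdiff n c (closure U) (closure V) u := hnull
  constructor
  · intro hfp hfm X hX hXm
    set Y := cSubdiffImg n c (closure U) (closure V) u X with hY
    have hYV : Y ⊆ closure V := by
      intro y hy
      simp only [hY, cSubdiffImg, mem_iUnion] at hy
      obtain ⟨x, _, hy⟩ := hy
      exact hy.2.1
    let T := toMeasurable volume Y ∩ closure V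
    have hTm : MeasurableSet T := (measurableSet_toMeasurable _ _).inter isClosed_closure.measurableSet
    have hYT : Y ⊆ T := fun y hy => ⟨subset_toMeasurable _ _ hy, hYV hy⟩
    have hvT : volume T ≤ volume Y := by
      rw [← measure_toMeasurable Y]
      exact measure_mono inter_subset_left
    have h1 : γ (Prod.fst ⁻¹' X) ≤ γ (Prod.snd ⁻¹' T) := by
      apply measure_mono_ae
      filter_upwards [hmemN] with p hp hpX
      refine hYT ?_
      simp only [hY, cSubdiffImg, mem_iUnion]
      exact ⟨p.1, hpX, hp⟩
    rw [← Measure.map_apply measurable_fst hXm, ← Measure.map_apply measurable_snd hTm,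
      hfst, hsnd, withDensity_apply _ hXm, withDensity_apply _ hTm] at h1
    have h2 : ENNReal.ofReal lam * volume X ≤ ∫⁻ x in X, ENNReal.ofReal (fp x) := by
      rw [← setLIntegral_const]
      exact setLIntegral_mono' hXm fun x hx => ENNReal.ofReal_le_ofReal (hfp x (hX hx))
    have h3 : ∫⁻ y in T, ENNReal.ofReal (fm y) ≤ ENNReal.ofReal Lam * volume T := by
      rw [← setLIntegral_const]
      exact setLIntegral_mono' hTm fun y hy => ENNReal.ofReal_le_ofReal (hfm y hy.2)
    have h4 : ENNReal.ofReal lam * volume X ≤ ENNReal.ofReal Lam * volume Y :=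
      h2.trans (h1.trans (h3.trans (by gcongr)))
    rw [ENNReal.ofReal_div_of_pos hLam, div_eq_mul_inv, mul_right_comm, ← div_eq_mul_inv]
    exact ENNReal.div_le_of_le_mul' h4
  · intro hfp hfm X hX hXm
    obtain ⟨p₀, hp₀⟩ := hmemN.exists
    have hbb := aux_bdd hAc hBc ⟨_, hp₀.2.1⟩ hc.continuousOn hu
    have hcl := aux_closed isClosed_closure isClosed_closure ⟨_, hp₀.1⟩ ⟨_, hp₀.2.1⟩
      hc.continuousOn hu hbb
    have huniq : ∀ᵐ y ∂(volume : Measure (Euc n)), ∀ x₁ x₂,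
        (x₁, y) ∈ cSubdiff n c (closure U) (closure V) u →
        (x₂, y) ∈ cSubdiff n c (closure U) (closure V) u → x₁ = x₂ := by
      rcases subsingleton_or_nontrivial (Euc n) with hs | hs
      · exact Eventually.of_forall fun y x₁ x₂ _ _ => Subsingleton.elim _ _
      · have : PerfectSpace (Euc n) := perfectSpace_of_module ℝ (Euc n)
        exact aux_null hc hUo.perfect_closure.acc hB1.1 hbb
    obtain ⟨N, hNsub, hNm, hN0⟩ := exists_measurable_superset_of_null (ae_iff.1 huniq)
    have hN : ∀ y, y ∉ N → ∀ x₁ x₂,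
        (x₁, y) ∈ cSubdiff n c (closure U) (closure V) u →
        (x₂, y) ∈ cSubdiff n c (closure U) (closure V) u → x₁ = x₂ := by
      intro y hy
      by_contra hcon
      exact hy (hNsub hcon)
    let W := (cSubdiff n c (closure U) (closure V) u ∩ Prod.fst ⁻¹' X) ∩ Prod.snd ⁻¹' Nᶜ
    have hWm : MeasurableSet W :=
      (hcl.measurableSet.inter (measurable_fst hXm)).inter (measurable_snd hNm.compl)
    let T := Prod.snd '' W
    have hTm : MeasurableSet T := by
      apply hWm.image_of_measurable_injOn measurable_snd
      rintro ⟨x₁, y₁⟩ h₁ ⟨x₂, y₂⟩ h₂ (rfl : y₁ = y₂)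
      rw [hN y₁ h₁.2 x₁ x₂ h₁.1.1 h₂.1.1]
    have hTV : T ⊆ closure V := by
      rintro _ ⟨p, hp, rfl⟩
      exact hp.1.1.2.1
    have hYT : volume (cSubdiffImg n c (closure U) (closure V) u X) ≤ volume T := by
      have hsub : cSubdiffImg n c (closure U) (closure V) u X ⊆ T ∪ N := by
        intro y hy
        simp only [cSubdiffImg, mem_iUnion] at hy
        obtain ⟨x, hx, hy⟩ := hy
        by_cases hyN : y ∈ N
        · exact Or.inr hyN
        · exact Or.inl ⟨(x, y), ⟨⟨hy, hx⟩, hyN⟩, rfl⟩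
      calc _ ≤ volume (T ∪ N) := measure_mono hsub
        _ ≤ volume T + volume N := measure_union_le _ _
        _ = volume T := by rw [hN0, add_zero]
    have h1 : γ (Prod.snd ⁻¹' T) ≤ γ (Prod.fst ⁻¹' X) := by
      apply measure_mono_ae
      filter_upwards [hmemN] with p hp hpT
      obtain ⟨⟨x, y⟩, hxy, hyp⟩ := hpT
      obtain ⟨a, b⟩ := p
      simp only at hyp
      subst hyp
      have := hN y hxy.2 a x hp hxy.1.1
      change a ∈ X
      rw [this]
      exact hxy.1.2
    rw [← Measure.map_apply measurable_fst hXm, ← Measure.map_apply measurable_snd hTm,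
      hfst, hsnd, withDensity_apply _ hXm, withDensity_apply _ hTm] at h1
    have h2 : ∫⁻ x in X, ENNReal.ofReal (fp x) ≤ ENNReal.ofReal Lam * volume X := by
      rw [← setLIntegral_const]
      exact setLIntegral_mono' hXm fun x hx => ENNReal.ofReal_le_ofReal (hfp x (hX hx))
    have h3 : ENNReal.ofReal lam * volume T ≤ ∫⁻ y in T, ENNReal.ofReal (fm y) := by
      rw [← setLIntegral_const]
      exact setLIntegral_mono' hTm fun y hy => ENNReal.ofReal_le_ofReal (hfm y (hTV hy))
    have h4 : ENNReal.ofReal lam * volume T ≤ ENNReal.ofReal Lam * volume X :=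
      h3.trans (h1.trans h2)
    refine hYT.trans ?_
    rw [ENNReal.ofReal_div_of_pos hlam, div_eq_mul_inv, mul_right_comm, ← div_eq_mul_inv]
    rw [ENNReal.le_div_iff_mul_le (Or.inl (by simpa using hlam)) (Or.inl ENNReal.ofReal_ne_top),
      mul_comm]
    exact h4
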